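/- Let ρ^i_a : ℝ^d → ℝ (1 ≤ i ≤ d, 1 ≤ a ≤ r) and C^c_{ab} : ℝ^d → ℝ with C^c_{ab} = −C^c_{ba} be arbitrary smooth functions. Then the following are equivalent: (a) ({}^Ed({}^Ed f))_{ab} = 0 for every smooth f : ℝ^d → ℝ and all a, b, and ({}^Ed({}^Ed α))_{abc} = 0 for every family of smooth functions α_a : ℝ^d → ℝ and all a, b, c; (b) the Lie algebroid identities hold: (L1) Σ_j (ρ^j_a ∂_j ρ^i_b − ρ^j_b ∂_j ρ^i_a) = Σ_c C^c_{ab} ρ^i_c for all i, a, b, and (L2) Σ_d C^e_{ad} C^d_{bc} + Σ_i ρ^i_a ∂_i C^e_{bc} + (cyclic permutations of (a,b,c)) = 0 for all a, b, c, e. (This is the coordinate form of the statement that the degree-one vector field Q = ρ^i_a q^a ∂/∂x^i − (1/2) C^c_{ab} q^a q^b ∂/∂q^c satisfies Q² = 0 if and only if (ρ, C) define a Lie algebroid.) -/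

import Mathlib

open scoped BigOperators

noncomputable section

/-- Partial derivative `∂_j f (p)` of a scalar function on `ℝ^d`. -/
def pd {d : ℕ} (j : Fin d) (f : (Fin d → ℝ) → ℝ) (p : Fin d → ℝ) : ℝ :=
  fderiv ℝ f p (Pi.single j 1)

/-- Lie algebroid differential on functions: `({}^Ed f)_a = Σ_i ρ^i_a ∂_i f`.
Here `ρ a i` denotes `ρ^i_a`. -/
def Ed0 {d r : ℕ} (ρ : Fin r → Fin d → (Fin d → ℝ) → ℝ)
    (f : (Fin d → ℝ) → ℝ) : Fin r → (Fin d → ℝ) → ℝ :=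
  fun a p => ∑ i, ρ a i p * pd i f p

/-- Lie algebroid differential on `E`-1-forms:
`({}^Ed α)_{ab} = Σ_i (ρ^i_a ∂_i α_b − ρ^i_b ∂_i α_a) − Σ_c C^c_{ab} α_c`.
Here `C a b c` denotes `C^c_{ab}`. -/
def Ed1 {d r : ℕ} (ρ : Fin r → Fin d → (Fin d → ℝ) → ℝ)
    (C : Fin r → Fin r → Fin r → (Fin d → ℝ) → ℝ)
    (α : Fin r → (Fin d → ℝ) → ℝ) : Fin r → Fin r → (Fin d → ℝ) → ℝ :=
  fun a b p => (∑ i, (ρ a i p * pd i (α b) p - ρ b i p * pd i (α a) p))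
    - ∑ c, C a b c p * α c p

/-- Lie algebroid differential on `E`-2-forms:
`({}^Ed β)_{abc} = Σ_i (ρ^i_a ∂_i β_{bc} − ρ^i_b ∂_i β_{ac} + ρ^i_c ∂_i β_{ab})
  − Σ_e (C^e_{ab} β_{ec} − C^e_{ac} β_{eb} + C^e_{bc} β_{ea})`. -/
def Ed2 {d r : ℕ} (ρ : Fin r → Fin d → (Fin d → ℝ) → ℝ)
    (C : Fin r → Fin r → Fin r → (Fin d → ℝ) → ℝ)
    (β : Fin r → Fin r → (Fin d → ℝ) → ℝ) : Fin r → Fin r → Fin r → (Fin d → ℝ) → ℝ :=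
  fun a b c p =>
    (∑ i, (ρ a i p * pd i (β b c) p - ρ b i p * pd i (β a c) p + ρ c i p * pd i (β a b) p))
    - ∑ e, (C a b e p * β e c p - C a c e p * β e b p + C b c e p * β e a p)

/-- The Lie algebroid identity (L1):
`Σ_j (ρ^j_a ∂_j ρ^i_b − ρ^j_b ∂_j ρ^i_a) = Σ_c C^c_{ab} ρ^i_c`. -/
def LieAlgebroidL1 {d r : ℕ} (ρ : Fin r → Fin d → (Fin d → ℝ) → ℝ)
    (C : Fin r → Fin r → Fin r → (Fin d → ℝ) → ℝ) : Prop :=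
  ∀ (i : Fin d) (a b : Fin r) (p : Fin d → ℝ),
    ∑ j, (ρ a j p * pd j (ρ b i) p - ρ b j p * pd j (ρ a i) p) = ∑ c, C a b c p * ρ c i p

/-- The Lie algebroid identity (L2):
`Σ_d C^e_{ad} C^d_{bc} + Σ_i ρ^i_a ∂_i C^e_{bc} + (cyclic in (a,b,c)) = 0`. -/
def LieAlgebroidL2 {d r : ℕ} (ρ : Fin r → Fin d → (Fin d → ℝ) → ℝ)
    (C : Fin r → Fin r → Fin r → (Fin d → ℝ) → ℝ) : Prop :=
  ∀ (a b c e : Fin r) (p : Fin d → ℝ),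
    ((∑ f, C a f e p * C b c f p) + ∑ i, ρ a i p * pd i (C b c e) p)
    + ((∑ f, C b f e p * C c a f p) + ∑ i, ρ b i p * pd i (C c a e) p)
    + ((∑ f, C c f e p * C a b f p) + ∑ i, ρ c i p * pd i (C a b e) p) = 0

section PartialDerivatives

variable {d : ℕ} {f g : (Fin d → ℝ) → ℝ} {p : Fin d → ℝ}

lemma pd_sub (i : Fin d) (hf : DifferentiableAt ℝ f p) (hg : DifferentiableAt ℝ g p) :
    pd i (fun q => f q - g q) p = pd i f p - pd i g p := by
  simp [pd, fderiv_fun_sub hf hg]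

lemma pd_neg (i : Fin d) : pd i (fun q => -f q) p = -pd i f p := by
  simp [pd, fderiv_fun_neg]

lemma pd_mul (i : Fin d) (hf : DifferentiableAt ℝ f p) (hg : DifferentiableAt ℝ g p) :
    pd i (fun q => f q * g q) p = f p * pd i g p + g p * pd i f p := by
  simp [pd, fderiv_fun_mul hf hg]

lemma pd_sum {ι : Type*} (s : Finset ι) {F : ι → (Fin d → ℝ) → ℝ} (i : Fin d)
    (hF : ∀ k ∈ s, DifferentiableAt ℝ (F k) p) :
    pd i (fun q => ∑ k ∈ s, F k q) p = ∑ k ∈ s, pd i (F k) p := by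
  simp [pd, fderiv_fun_sum hF]

lemma pd_const (i : Fin d) (c : ℝ) : pd i (fun _ => c) p = 0 := by
  simp [pd]

lemma pd_coord (i j : Fin d) :
    pd i (fun q : Fin d → ℝ => q j) p = if j = i then 1 else 0 := by
  simp [pd, fderiv_apply, Pi.single_apply]

lemma contDiff_pd (i : Fin d) (hf : ContDiff ℝ (⊤ : ℕ∞) f) :
    ContDiff ℝ (⊤ : ℕ∞) (pd i f) :=
  (hf.fderiv_right (m := (⊤ : ℕ∞)) (by simp)).clm_apply contDiff_const

lemma pd_comm (i j : Fin d) (hf : ContDiff ℝ (⊤ : ℕ∞) f) :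
    pd i (pd j f) p = pd j (pd i f) p := by
  have hd : DifferentiableAt ℝ (fderiv ℝ f) p :=
    ((hf.fderiv_right (m := (⊤ : ℕ∞)) (by simp)).differentiable (by simp)).differentiableAt
  have key (k l : Fin d) :
      pd k (pd l f) p = fderiv ℝ (fderiv ℝ f) p (Pi.single k 1) (Pi.single l 1) := by
    change fderiv ℝ (fun q => fderiv ℝ f q (Pi.single l 1)) p (Pi.single k 1) = _
    simp [fderiv_clm_apply hd (differentiableAt_const _)]
  rw [key, key]
  exact (hf.contDiffAt.isSymmSndFDerivAt
    (by simpa using WithTop.coe_le_coe.2 (le_top : (2 : ℕ∞) ≤ ⊤))).eq _ _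

end PartialDerivatives

section Anchor

variable {d r : ℕ} {ρ : Fin r → Fin d → (Fin d → ℝ) → ℝ}
  {f g : (Fin d → ℝ) → ℝ} {p : Fin d → ℝ}

lemma Ed0_sub (a : Fin r) (hf : DifferentiableAt ℝ f p) (hg : DifferentiableAt ℝ g p) :
    Ed0 ρ (fun q => f q - g q) a p = Ed0 ρ f a p - Ed0 ρ g a p := by
  simp [Ed0, pd_sub _ hf hg, mul_sub, Finset.sum_sub_distrib]

lemma Ed0_neg (a : Fin r) : Ed0 ρ (fun q => -f q) a p = -Ed0 ρ f a p := by
  simp [Ed0, pd_neg]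

lemma Ed0_mul (a : Fin r) (hf : DifferentiableAt ℝ f p) (hg : DifferentiableAt ℝ g p) :
    Ed0 ρ (fun q => f q * g q) a p = f p * Ed0 ρ g a p + g p * Ed0 ρ f a p := by
  simp only [Ed0, pd_mul _ hf hg, Finset.mul_sum, ← Finset.sum_add_distrib]
  exact Finset.sum_congr rfl fun _ _ => by ring

lemma Ed0_sum {ι : Type*} (s : Finset ι) {F : ι → (Fin d → ℝ) → ℝ} (a : Fin r)
    (hF : ∀ k ∈ s, DifferentiableAt ℝ (F k) p) :
    Ed0 ρ (fun q => ∑ k ∈ s, F k q) a p = ∑ k ∈ s, Ed0 ρ (F k) a p := by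
  simp only [Ed0, pd_sum s _ hF, Finset.mul_sum]
  exact Finset.sum_comm

lemma contDiff_Ed0 (hρ : ∀ a i, ContDiff ℝ (⊤ : ℕ∞) (ρ a i)) (hf : ContDiff ℝ (⊤ : ℕ∞) f)
    (a : Fin r) : ContDiff ℝ (⊤ : ℕ∞) (Ed0 ρ f a) :=
  ContDiff.sum fun i _ => (hρ a i).mul (contDiff_pd i hf)

/-- The commutator of two anchored vector fields is again a vector field. -/
lemma Ed0_commutator (hρ : ∀ a i, ContDiff ℝ (⊤ : ℕ∞) (ρ a i))
    (hf : ContDiff ℝ (⊤ : ℕ∞) f) (a b : Fin r) :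
    Ed0 ρ (Ed0 ρ f b) a p - Ed0 ρ (Ed0 ρ f a) b p
      = ∑ i, (Ed0 ρ (ρ b i) a p - Ed0 ρ (ρ a i) b p) * pd i f p := by
  have smooth {g : (Fin d → ℝ) → ℝ} (hg : ContDiff ℝ (⊤ : ℕ∞) g) : DifferentiableAt ℝ g p :=
    (hg.differentiable (by simp)).differentiableAt
  have expand (a b : Fin r) : Ed0 ρ (Ed0 ρ f b) a p
      = ∑ i, Ed0 ρ (ρ b i) a p * pd i f p
        + ∑ i, ∑ j, ρ b i p * (ρ a j p * pd j (pd i f) p) := by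
    change Ed0 ρ (fun q => ∑ i, ρ b i q * pd i f q) a p = _
    rw [Ed0_sum _ _ fun i _ => smooth ((hρ b i).mul (contDiff_pd i hf)),
      ← Finset.sum_add_distrib]
    refine Finset.sum_congr rfl fun i _ => ?_
    rw [Ed0_mul _ (smooth (hρ b i)) (smooth (contDiff_pd i hf)), ← Finset.mul_sum, add_comm,
      mul_comm (pd i f p)]
    rfl
  have symm : ∑ i, ∑ j, ρ b i p * (ρ a j p * pd j (pd i f) p)
      = ∑ i, ∑ j, ρ a i p * (ρ b j p * pd j (pd i f) p) := by
    rw [Finset.sum_comm]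
    refine Finset.sum_congr rfl fun i _ => Finset.sum_congr rfl fun j _ => ?_
    rw [pd_comm i j hf]
    ring
  rw [expand a b, expand b a, symm]
  simp only [sub_mul, Finset.sum_sub_distrib]
  ring

end Anchor

section Defects

variable {d r : ℕ} {ρ : Fin r → Fin d → (Fin d → ℝ) → ℝ}
  {C : Fin r → Fin r → Fin r → (Fin d → ℝ) → ℝ} {p : Fin d → ℝ}

/-- The failure of the anchor to be compatible with the brackets. -/
def anchorDefect (ρ : Fin r → Fin d → (Fin d → ℝ) → ℝ)
    (C : Fin r → Fin r → Fin r → (Fin d → ℝ) → ℝ) (a b : Fin r) (i : Fin d)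
    (p : Fin d → ℝ) : ℝ :=
  Ed0 ρ (ρ b i) a p - Ed0 ρ (ρ a i) b p - ∑ c, C a b c p * ρ c i p

/-- The failure of the Jacobi identity. -/
def jacobiDefect (ρ : Fin r → Fin d → (Fin d → ℝ) → ℝ)
    (C : Fin r → Fin r → Fin r → (Fin d → ℝ) → ℝ) (a b c e : Fin r)
    (p : Fin d → ℝ) : ℝ :=
  ((∑ f, C a f e p * C b c f p) + Ed0 ρ (C b c e) a p)
    + ((∑ f, C b f e p * C c a f p) + Ed0 ρ (C c a e) b p)
    + ((∑ f, C c f e p * C a b f p) + Ed0 ρ (C a b e) c p)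

lemma lieAlgebroidL1_iff :
    LieAlgebroidL1 ρ C ↔ ∀ a b i p, anchorDefect ρ C a b i p = 0 := by
  simp only [LieAlgebroidL1, anchorDefect, Ed0, ← Finset.sum_sub_distrib, sub_eq_zero]
  simp only [Finset.sum_sub_distrib]
  exact ⟨fun h a b i p => h i a b p, fun h i a b p => h a b i p⟩

lemma lieAlgebroidL2_iff :
    LieAlgebroidL2 ρ C ↔ ∀ a b c e p, jacobiDefect ρ C a b c e p = 0 :=
  Iff.rfl

lemma Ed1_apply (α : Fin r → (Fin d → ℝ) → ℝ) (a b : Fin r) :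
    Ed1 ρ C α a b = fun p =>
      Ed0 ρ (α b) a p - Ed0 ρ (α a) b p - ∑ c, C a b c p * α c p := by
  ext p
  simp [Ed1, Ed0, Finset.sum_sub_distrib]

lemma Ed2_apply (β : Fin r → Fin r → (Fin d → ℝ) → ℝ) (a b c : Fin r) :
    Ed2 ρ C β a b c p = Ed0 ρ (β b c) a p - Ed0 ρ (β a c) b p + Ed0 ρ (β a b) c p
      - (∑ e, C a b e p * β e c p - ∑ e, C a c e p * β e b p + ∑ e, C b c e p * β e a p) := by
  simp [Ed2, Ed0, Finset.sum_sub_distrib, Finset.sum_add_distrib]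

lemma sum_anchorDefect_mul_pd (hρ : ∀ a i, ContDiff ℝ (⊤ : ℕ∞) (ρ a i))
    {f : (Fin d → ℝ) → ℝ} (hf : ContDiff ℝ (⊤ : ℕ∞) f) (a b : Fin r) :
    ∑ i, anchorDefect ρ C a b i p * pd i f p
      = Ed0 ρ (Ed0 ρ f b) a p - Ed0 ρ (Ed0 ρ f a) b p - ∑ c, C a b c p * Ed0 ρ f c p := by
  rw [Ed0_commutator hρ hf]
  simp only [anchorDefect, sub_mul, Finset.sum_sub_distrib, Finset.sum_mul, Ed0, Finset.mul_sum,
    mul_assoc]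
  rw [Finset.sum_comm (f := fun i c => C a b c p * (ρ c i p * pd i f p))]

lemma Ed1_Ed0 (hρ : ∀ a i, ContDiff ℝ (⊤ : ℕ∞) (ρ a i))
    {f : (Fin d → ℝ) → ℝ} (hf : ContDiff ℝ (⊤ : ℕ∞) f) (a b : Fin r) :
    Ed1 ρ C (Ed0 ρ f) a b p = ∑ i, anchorDefect ρ C a b i p * pd i f p := by
  rw [sum_anchorDefect_mul_pd hρ hf, Ed1_apply]

lemma Ed0_Ed1 (hρ : ∀ a i, ContDiff ℝ (⊤ : ℕ∞) (ρ a i))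
    (hC : ∀ a b c, ContDiff ℝ (⊤ : ℕ∞) (C a b c))
    {α : Fin r → (Fin d → ℝ) → ℝ} (hα : ∀ a, ContDiff ℝ (⊤ : ℕ∞) (α a)) (a b c : Fin r) :
    Ed0 ρ (Ed1 ρ C α b c) a p = Ed0 ρ (Ed0 ρ (α c) b) a p - Ed0 ρ (Ed0 ρ (α b) c) a p
      - (∑ e, C b c e p * Ed0 ρ (α e) a p + ∑ e, Ed0 ρ (C b c e) a p * α e p) := by
  have smooth {g : (Fin d → ℝ) → ℝ} (hg : ContDiff ℝ (⊤ : ℕ∞) g) : DifferentiableAt ℝ g p :=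
    (hg.differentiable (by simp)).differentiableAt
  have h1 := contDiff_Ed0 hρ (hα c) b
  have h2 := contDiff_Ed0 hρ (hα b) c
  have h3 (e : Fin r) := (hC b c e).mul (hα e)
  rw [Ed1_apply, Ed0_sub _ (smooth (h1.sub h2)) (smooth (ContDiff.sum fun e _ => h3 e)),
    Ed0_sub _ (smooth h1) (smooth h2), Ed0_sum _ _ fun e _ => smooth (h3 e),
    ← Finset.sum_add_distrib]
  congr 1
  refine Finset.sum_congr rfl fun e _ => ?_
  rw [Ed0_mul _ (smooth (hC b c e)) (smooth (hα e)), mul_comm (α e p)]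

lemma sum_mul_Ed1 (α : Fin r → (Fin d → ℝ) → ℝ) (a b c : Fin r) :
    ∑ e, C a b e p * Ed1 ρ C α e c p
      = ∑ e, C a b e p * Ed0 ρ (α c) e p - ∑ e, C a b e p * Ed0 ρ (α e) c p
        - ∑ e, (∑ f, C f c e p * C a b f p) * α e p := by
  simp only [Ed1_apply, mul_sub, Finset.sum_sub_distrib, Finset.mul_sum, Finset.sum_mul]
  congr 1
  rw [Finset.sum_comm]
  exact Finset.sum_congr rfl fun _ _ => Finset.sum_congr rfl fun _ _ => by ring

lemma sum_jacobiDefect_mul (hCanti : ∀ a b c, C a b c = fun p => -C b a c p)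
    (α : Fin r → (Fin d → ℝ) → ℝ) (a b c : Fin r) :
    ∑ e, jacobiDefect ρ C a b c e p * α e p
      = ∑ e, Ed0 ρ (C b c e) a p * α e p - ∑ e, Ed0 ρ (C a c e) b p * α e p
        + ∑ e, Ed0 ρ (C a b e) c p * α e p
        - ∑ e, (∑ f, C f c e p * C a b f p) * α e p
        + ∑ e, (∑ f, C f b e p * C a c f p) * α e p
        - ∑ e, (∑ f, C f a e p * C b c f p) * α e p := by
  simp only [← Finset.sum_sub_distrib, ← Finset.sum_add_distrib]
  refine Finset.sum_congr rfl fun e _ => ?_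
  have swap (x y z : Fin r) : C x y z p = -C y x z p := congrFun (hCanti x y z) p
  have h1 (x y z : Fin r) :
      ∑ f, C x f e p * C y z f p = -∑ f, C f x e p * C y z f p := by
    rw [← Finset.sum_neg_distrib]
    exact Finset.sum_congr rfl fun f _ => by rw [swap x f]; ring
  have h2 : ∑ f, C f b e p * C c a f p = -∑ f, C f b e p * C a c f p := by
    rw [← Finset.sum_neg_distrib]
    exact Finset.sum_congr rfl fun f _ => by rw [swap c a]; ring
  rw [jacobiDefect, h1 a, h1 b, h1 c, h2, hCanti c a e, Ed0_neg]
  ring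

lemma Ed2_Ed1 (hρ : ∀ a i, ContDiff ℝ (⊤ : ℕ∞) (ρ a i))
    (hC : ∀ a b c, ContDiff ℝ (⊤ : ℕ∞) (C a b c))
    (hCanti : ∀ a b c, C a b c = fun p => -C b a c p)
    {α : Fin r → (Fin d → ℝ) → ℝ} (hα : ∀ a, ContDiff ℝ (⊤ : ℕ∞) (α a)) (a b c : Fin r) :
    Ed2 ρ C (Ed1 ρ C α) a b c p
      = ∑ i, anchorDefect ρ C a b i p * pd i (α c) p
        - ∑ i, anchorDefect ρ C a c i p * pd i (α b) p
        + ∑ i, anchorDefect ρ C b c i p * pd i (α a) p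
        - ∑ e, jacobiDefect ρ C a b c e p * α e p := by
  rw [sum_jacobiDefect_mul hCanti, Ed2_apply]
  simp only [sum_anchorDefect_mul_pd hρ (hα _), Ed0_Ed1 hρ hC hα, sum_mul_Ed1]
  ring

end Defects

/-- for arbitrary smooth coefficients `ρ, C` (with `C` antisymmetric),
the Lie algebroid differential squares to zero (on functions and on `E`-1-forms)
if and only if the Lie algebroid identities (L1) and (L2) hold.  This is the
coordinate form of `Q² = 0 ⟺ (ρ, C)` defines a Lie algebroid. -/
theorem Ed_squared_iff_lie_algebroid {d r : ℕ}
    (ρ : Fin r → Fin d → (Fin d → ℝ) → ℝ)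
    (C : Fin r → Fin r → Fin r → (Fin d → ℝ) → ℝ)
    (hρs : ∀ a i, ContDiff ℝ (⊤ : ℕ∞) (ρ a i))
    (hCs : ∀ a b c, ContDiff ℝ (⊤ : ℕ∞) (C a b c))
    (hCanti : ∀ a b c, C a b c = fun p => -C b a c p) :
    ((∀ f : (Fin d → ℝ) → ℝ, ContDiff ℝ (⊤ : ℕ∞) f → ∀ a b, Ed1 ρ C (Ed0 ρ f) a b = 0)
      ∧ (∀ α : Fin r → (Fin d → ℝ) → ℝ, (∀ a, ContDiff ℝ (⊤ : ℕ∞) (α a)) →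
          ∀ a b c, Ed2 ρ C (Ed1 ρ C α) a b c = 0))
    ↔ (LieAlgebroidL1 ρ C ∧ LieAlgebroidL2 ρ C) := by
  rw [lieAlgebroidL1_iff, lieAlgebroidL2_iff]
  constructor
  · rintro ⟨h0, h1⟩
    have anchor : ∀ a b i p, anchorDefect ρ C a b i p = 0 := by
      intro a b i p
      have hx : ContDiff ℝ (⊤ : ℕ∞) (fun q : Fin d → ℝ => q i) := contDiff_apply ℝ ℝ i
      have h := congrFun (h0 _ hx a b) p
      rw [Ed1_Ed0 hρs hx] at h
      simpa [pd_coord] using h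
    refine ⟨anchor, fun a b c e p => ?_⟩
    have hα (x : Fin r) :
        ContDiff ℝ (⊤ : ℕ∞) (fun _ : Fin d → ℝ => if x = e then (1 : ℝ) else 0) :=
      contDiff_const
    have h := congrFun (h1 _ hα a b c) p
    rw [Ed2_Ed1 hρs hCs hCanti hα] at h
    simpa [anchor] using h
  · rintro ⟨anchor, jacobi⟩
    refine ⟨fun f hf a b => funext fun p => ?_, fun α hα a b c => funext fun p => ?_⟩
    · simp [Ed1_Ed0 hρs hf, anchor]
    · simp [Ed2_Ed1 hρs hCs hCanti hα, anchor, jacobi]
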